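/- arXiv:2010.08576 — 5 statements merged into one kernel-verified Lean document; each statement's English description precedes it below -/
import Mathlib

section
/- There exists a constant c > 0 such that the following holds: for every integer d ≥ 1 and all integers a, b with 0 ≤ a ≤ d, 0 ≤ b ≤ d, and d dividing a·b, letting k := a·b/d, one has C(a, k) · C(d - a, b - k) ≥ (c/d) · C(d, b). (Equivalently: if A ⊆ {1,…,d} has |A| = αd and B is chosen uniformly at random among subsets of {1,…,d} of size βd, then Pr[|A ∩ B| = αβd] ≥ Ω(1/d).) -/
theorem Nat.choose_succ_mul_choose_mul (m n i j : ℕ) :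
    m.choose (i + 1) * n.choose j * ((i + 1) * (n - j)) =
      m.choose i * n.choose (j + 1) * ((m - i) * (j + 1)) := by
  calc _ = (m.choose (i + 1) * (i + 1)) * (n.choose j * (n - j)) := by ring
    _ = (m.choose i * (m - i)) * (n.choose (j + 1) * (j + 1)) := by
        rw [Nat.choose_succ_right_eq, Nat.choose_succ_right_eq]
    _ = _ := by ring

/-- If the mean `k` of a hypergeometric distribution is an integer, then it is a mode. -/
theorem Nat.choose_mul_choose_le_of_mul_eq {m n b k : ℕ} (hd : 0 < m + n) (hb : b ≤ m + n)
    (hk : k * (m + n) = m * b) {i : ℕ} (hi : i ≤ b) :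
    m.choose i * n.choose (b - i) ≤ m.choose k * n.choose (b - k) := by
  have hkm : k ≤ m := Nat.le_of_mul_le_mul_right (by rw [hk]; gcongr) hd
  have hkb : k ≤ b := Nat.le_of_mul_le_mul_right (by rw [hk]; nlinarith) hd
  have hbk : b ≤ n + k := Nat.le_of_mul_le_mul_right (by nlinarith) hd
  rcases le_total i k with hik | hki
  · induction hik using Nat.decreasingInduction with
    | self => exact le_rfl
    | of_succ j hj ih =>
      refine le_trans ?_ (ih (by omega))
      obtain ⟨l, rfl⟩ : ∃ l, b = j + 1 + l := ⟨b - (j + 1), by omega⟩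
      have e := Nat.choose_succ_mul_choose_mul m n j (j + 1 + l - (j + 1))
      rw [show j + 1 + l - (j + 1) = l by omega] at *
      rw [show j + 1 + l - j = l + 1 by omega]
      obtain ⟨x, rfl⟩ : ∃ x, m = j + x := ⟨m - j, by omega⟩
      rw [show j + x - j = x by omega] at e
      refine Nat.le_of_mul_le_mul_right (e.symm.le.trans (Nat.mul_le_mul_left _ ?_))
        (show 0 < x * (l + 1) from Nat.mul_pos (by omega) (by omega))
      rcases le_total n l with h | h
      · simp [Nat.sub_eq_zero_of_le h]
      · obtain ⟨y, rfl⟩ := Nat.exists_eq_add_of_le h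
        rw [Nat.add_sub_cancel_left]
        nlinarith
  · induction i, hki using Nat.le_induction with
    | base => exact le_rfl
    | succ j hj ih =>
      refine le_trans ?_ (ih (by omega))
      obtain ⟨l, rfl⟩ : ∃ l, b = j + 1 + l := ⟨b - (j + 1), by omega⟩
      have e := Nat.choose_succ_mul_choose_mul m n j (j + 1 + l - (j + 1))
      rw [show j + 1 + l - (j + 1) = l by omega] at *
      rw [show j + 1 + l - j = l + 1 by omega]
      obtain ⟨y, rfl⟩ : ∃ y, n = l + y := ⟨n - l, by omega⟩
      rw [show l + y - l = y by omega] at e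
      refine Nat.le_of_mul_le_mul_right (e.le.trans (Nat.mul_le_mul_left _ ?_))
        (show 0 < (j + 1) * y from Nat.mul_pos (by omega) (by omega))
      rcases le_total m j with h | h
      · simp [Nat.sub_eq_zero_of_le h]
      · obtain ⟨x, rfl⟩ := Nat.exists_eq_add_of_le h
        rw [Nat.add_sub_cancel_left]
        nlinarith

theorem Nat.choose_add_le_succ_mul_of_mul_eq {m n b k : ℕ} (hd : 0 < m + n) (hb : b ≤ m + n)
    (hk : k * (m + n) = m * b) :
    (m + n).choose b ≤ (b + 1) * (m.choose k * n.choose (b - k)) := by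
  rw [Nat.add_choose_eq, ← Finset.Nat.card_antidiagonal b, ← smul_eq_mul (Finset.card _)]
  refine Finset.sum_le_card_nsmul _ _ _ fun p hp => ?_
  have h := Finset.HasAntidiagonal.mem_antidiagonal.mp hp
  rw [show p.2 = b - p.1 by omega]
  exact Nat.choose_mul_choose_le_of_mul_eq hd hb hk (by omega)

/-- There is a constant `c > 0` such that for every `d ≥ 1`, `a ≤ d`, `b ≤ d`
with `d ∣ a·b` and `k := a·b/d`, one has `C(a,k)·C(d-a,b-k) ≥ (c/d)·C(d,b)`. -/
theorem stmt_7 :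
    ∃ c : ℝ, 0 < c ∧ ∀ d a b : ℕ, 1 ≤ d → a ≤ d → b ≤ d → d ∣ a * b →
      (c / d) * (d.choose b : ℝ) ≤
        (a.choose (a * b / d) : ℝ) * ((d - a).choose (b - a * b / d) : ℝ) := by
  refine ⟨1 / 2, by norm_num, fun d a b hd ha hb hdvd => ?_⟩
  obtain ⟨n, rfl⟩ := Nat.exists_eq_add_of_le ha
  have h := Nat.choose_add_le_succ_mul_of_mul_eq hd hb (Nat.div_mul_cancel hdvd)
  rw [Nat.add_sub_cancel_left]
  generalize a * b / (a + n) = k at h ⊢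
  have h2 : (a + n).choose b ≤ 2 * (a + n) * (a.choose k * n.choose (b - k)) :=
    h.trans (Nat.mul_le_mul_right _ (by omega))
  have hpos : (0 : ℝ) < (a + n : ℕ) := by exact_mod_cast hd
  rw [div_mul_eq_mul_div, div_le_iff₀ hpos]
  have h3 : ((a + n).choose b : ℝ) ≤
      2 * (a + n : ℕ) * (a.choose k * n.choose (b - k)) := by exact_mod_cast h2
  linarith
end

section
/- Let w : ℕ → ℤ be a weight function, let M be a finite set of natural numbers, and let Q ⊆ M. Let ε ≥ 0 and 0 < λ ≤ 1 be reals with |Q| = λ·|M|. If M is an ε-mixer, i.e. |Σ_w(M)| ≥ 2^{(1-ε)|M|}, then Q is an ε'-mixer for some ε' ≤ ε/λ; concretely, |Σ_w(Q)| ≥ 2^{(1 - ε/λ)·|Q|} = 2^{(λ - ε)·|M|}. -/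
/-- The set of subset sums `Σ_w(A) = { ∑_{i ∈ X} w i : X ⊆ A }` of a finite set `A ⊆ ℕ`
with respect to a weight function `w : ℕ → ℤ`. -/
def subsetSums (w : ℕ → ℤ) (A : Finset ℕ) : Finset ℤ :=
  A.powerset.image (fun X => ∑ i ∈ X, w i)

open scoped Pointwise in
theorem subsetSums_subset_add_sdiff (w : ℕ → ℤ) (M Q : Finset ℕ) :
    subsetSums w M ⊆ subsetSums w Q + subsetSums w (M \ Q) := by
  intro z hz
  obtain ⟨X, hX, rfl⟩ := Finset.mem_image.mp hz
  rw [Finset.mem_powerset] at hX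
  refine Finset.mem_add.mpr ⟨_, Finset.mem_image_of_mem _ (Finset.mem_powerset.mpr
    (Finset.inter_subset_right : X ∩ Q ⊆ Q)), _, Finset.mem_image_of_mem _
    (Finset.mem_powerset.mpr (Finset.sdiff_subset_sdiff hX subset_rfl)), ?_⟩
  exact Finset.sum_inter_add_sum_sdiff X Q w

theorem card_subsetSums_le_two_pow (w : ℕ → ℤ) (A : Finset ℕ) :
    (subsetSums w A).card ≤ 2 ^ A.card :=
  Finset.card_image_le.trans_eq (Finset.card_powerset A)

open scoped Pointwise in
theorem card_subsetSums_le_mul_two_pow (w : ℕ → ℤ) {M Q : Finset ℕ} (hQM : Q ⊆ M) :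
    (subsetSums w M).card ≤ (subsetSums w Q).card * 2 ^ (M.card - Q.card) := by
  refine (Finset.card_le_card (subsetSums_subset_add_sdiff w M Q)).trans
    (Finset.card_add_le.trans (Nat.mul_le_mul_left _ ?_))
  rw [← Finset.card_sdiff_of_subset hQM]
  exact card_subsetSums_le_two_pow w _

/-- If `Q ⊆ M`, `|Q| = λ|M|` with `0 < λ ≤ 1`, `ε ≥ 0`, and `M` is an ε-mixer,
i.e. `|Σ_w(M)| ≥ 2^{(1-ε)|M|}`, then `|Σ_w(Q)| ≥ 2^{(1-ε/λ)|Q|} = 2^{(λ-ε)|M|}`. -/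
theorem stmt_9 (w : ℕ → ℤ) (M Q : Finset ℕ) (hQM : Q ⊆ M) (ε l : ℝ)
    (hε : 0 ≤ ε) (hl0 : 0 < l) (hl1 : l ≤ 1) (hQcard : (Q.card : ℝ) = l * M.card)
    (hmixer : (2 : ℝ) ^ ((1 - ε) * (M.card : ℝ)) ≤ ((subsetSums w M).card : ℝ)) :
    (2 : ℝ) ^ ((1 - ε / l) * (Q.card : ℝ)) ≤ ((subsetSums w Q).card : ℝ) ∧
      (2 : ℝ) ^ ((1 - ε / l) * (Q.card : ℝ)) = (2 : ℝ) ^ ((l - ε) * (M.card : ℝ)) := by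
  have hexp : (1 - ε / l) * (Q.card : ℝ) = (l - ε) * (M.card : ℝ) := by
    rw [hQcard]
    field_simp
  refine ⟨?_, by rw [hexp]⟩
  have hcard : ((subsetSums w M).card : ℝ) ≤
      (subsetSums w Q).card * (2 : ℝ) ^ ((M.card : ℝ) - Q.card) := by
    rw [← Nat.cast_sub (Finset.card_le_card hQM), Real.rpow_natCast]
    exact_mod_cast card_subsetSums_le_mul_two_pow w hQM
  have hsplit : (1 - ε) * (M.card : ℝ) =
      (1 - ε / l) * (Q.card : ℝ) + ((M.card : ℝ) - Q.card) := by
    rw [hexp, hQcard]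
    ring
  have hle := hmixer.trans hcard
  rw [hsplit, Real.rpow_add two_pos] at hle
  exact le_of_mul_le_mul_right hle (by positivity)
end

section
/- Let d be a positive integer divisible by 4. Let (X₁, Y₁), …, (X_z, Y_z) be a 1-cover of the disjointness matrix Disj_{d/4, d/4, d}: each X_i and Y_i is a family of size-(d/4) subsets of {1,…,d}, for every i and every A ∈ X_i, B ∈ Y_i one has A ∩ B = ∅, and for every pair of disjoint size-(d/4) subsets A, B of {1,…,d} there is an index i with A ∈ X_i and B ∈ Y_i. Then ∑_{i=1}^{z} (|X_i| + |Y_i|) ≥ C(d, d/4) · C(3d/4, d/4) / C(d/2, d/4). In particular, the sparsity ∑_i |X_i|/C(d,d/4) + ∑_i |Y_i|/C(d,d/4) of any such 1-cover is at least C(3d/4, d/4)/C(d/2, d/4), which is 2^d/C(d,d/4) up to factors polynomial in d. -/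
/-- Two cross-disjoint families of `k`-subsets of a set `S` with at most `2 * m` elements cannot
both have more than `m.choose k` members. -/
theorem min_card_le_choose_of_cross_disjoint {α : Type*} [DecidableEq α] {S : Finset α}
    {k m : ℕ} (hS : S.card ≤ 2 * m) {X Y : Finset (Finset α)}
    (hX : X ⊆ S.powersetCard k) (hY : Y ⊆ S.powersetCard k)
    (h : ∀ A ∈ X, ∀ B ∈ Y, Disjoint A B) :
    min X.card Y.card ≤ m.choose k := by
  have card_le : ∀ Z : Finset (Finset α), Z ⊆ S.powersetCard k → (Z.biUnion id).card ≤ m →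
      Z.card ≤ m.choose k := fun Z hZ hm => by
    have hsub : Z ⊆ (Z.biUnion id).powersetCard k := fun A hA =>
      Finset.mem_powersetCard.2
        ⟨Finset.subset_biUnion_of_mem id hA, (Finset.mem_powersetCard.1 (hZ hA)).2⟩
    calc Z.card ≤ ((Z.biUnion id).powersetCard k).card := Finset.card_le_card hsub
      _ = (Z.biUnion id).card.choose k := Finset.card_powersetCard _ _
      _ ≤ m.choose k := Nat.choose_le_choose k hm
  have union_subset : ∀ Z : Finset (Finset α), Z ⊆ S.powersetCard k → Z.biUnion id ⊆ S :=
    fun Z hZ => Finset.biUnion_subset.2 fun A hA => (Finset.mem_powersetCard.1 (hZ hA)).1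
  have hdisj : Disjoint (X.biUnion id) (Y.biUnion id) := by
    simpa only [Finset.disjoint_biUnion_left, Finset.disjoint_biUnion_right, id] using
      fun B hB A hA => h A hA B hB
  have hcard := Finset.card_le_card (Finset.union_subset (union_subset X hX) (union_subset Y hY))
  rw [Finset.card_union_of_disjoint hdisj] at hcard
  rcases le_total (X.biUnion id).card m with hm | hm
  · exact (min_le_left _ _).trans (card_le X hX hm)
  · exact (min_le_right _ _).trans (card_le Y hY (by omega))

/-- The number of ordered pairs of disjoint `k`-subsets of `S`. -/
theorem card_sigma_disjoint_powersetCard {α : Type*} [DecidableEq α] (S : Finset α) (k : ℕ) :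
    ((S.powersetCard k).sigma fun A => (S \ A).powersetCard k).card =
      S.card.choose k * (S.card - k).choose k := by
  rw [Finset.card_sigma, Finset.sum_congr rfl (g := fun _ => (S.card - k).choose k),
    Finset.sum_const, Finset.card_powersetCard, smul_eq_mul]
  intro A hA
  obtain ⟨hAS, hAk⟩ := Finset.mem_powersetCard.1 hA
  rw [Finset.card_powersetCard, Finset.card_sdiff_of_subset hAS, hAk]


/-- Any 1-cover `(X₁,Y₁),…,(X_z,Y_z)` of the disjointness matrix
`Disj_{d/4,d/4,d}` (rows and columns are the size-`d/4` subsets of `{1,…,d}`) satisfies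
`∑ᵢ (|Xᵢ| + |Yᵢ|) ≥ C(d, d/4) · C(3d/4, d/4) / C(d/2, d/4)`. -/
theorem stmt_12 (d : ℕ) (hd : 0 < d) (hd4 : 4 ∣ d) (z : ℕ)
    (X Y : Fin z → Finset (Finset ℕ))
    (hX : ∀ i, ∀ A ∈ X i, A ⊆ Finset.Icc 1 d ∧ A.card = d / 4)
    (hY : ∀ i, ∀ B ∈ Y i, B ⊆ Finset.Icc 1 d ∧ B.card = d / 4)
    (hrect : ∀ i, ∀ A ∈ X i, ∀ B ∈ Y i, Disjoint A B)
    (hcover : ∀ A B : Finset ℕ, A ⊆ Finset.Icc 1 d → B ⊆ Finset.Icc 1 d →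
      A.card = d / 4 → B.card = d / 4 → Disjoint A B → ∃ i, A ∈ X i ∧ B ∈ Y i) :
    ((d.choose (d / 4) : ℝ) * ((3 * d / 4).choose (d / 4) : ℝ)) /
        ((d / 2).choose (d / 4) : ℝ) ≤
      ∑ i, (((X i).card : ℝ) + ((Y i).card : ℝ)) := by
  have hXsub : ∀ i, X i ⊆ (Finset.Icc 1 d).powersetCard (d / 4) := fun i A hA =>
    Finset.mem_powersetCard.2 (hX i A hA)
  have hYsub : ∀ i, Y i ⊆ (Finset.Icc 1 d).powersetCard (d / 4) := fun i B hB =>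
    Finset.mem_powersetCard.2 (hY i B hB)
  have hmul : ∀ i, (X i).card * (Y i).card ≤
      ((X i).card + (Y i).card) * (d / 2).choose (d / 4) := fun i => by
    have hmin := min_card_le_choose_of_cross_disjoint (m := d / 2)
      (by rw [Nat.card_Icc]; omega) (hXsub i) (hYsub i) (hrect i)
    rcases min_le_iff.1 hmin with h | h <;> nlinarith
  have hpairs : ((Finset.Icc 1 d).powersetCard (d / 4)).sigma
        (fun A => (Finset.Icc 1 d \ A).powersetCard (d / 4)) ⊆
      Finset.univ.biUnion fun i => (X i).sigma fun _ => Y i := by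
    rintro ⟨A, B⟩ hAB
    obtain ⟨hA, hB⟩ := Finset.mem_sigma.1 hAB
    obtain ⟨hAS, hAk⟩ := Finset.mem_powersetCard.1 hA
    obtain ⟨hBS, hBk⟩ := Finset.mem_powersetCard.1 hB
    obtain ⟨hBS, hdisj⟩ := Finset.subset_sdiff.1 hBS
    obtain ⟨i, hAi, hBi⟩ := hcover A B hAS hBS hAk hBk hdisj.symm
    exact Finset.mem_biUnion.2 ⟨i, Finset.mem_univ i, Finset.mem_sigma.2 ⟨hAi, hBi⟩⟩
  have hcount : d.choose (d / 4) * (3 * d / 4).choose (d / 4) ≤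
      (∑ i, ((X i).card + (Y i).card)) * (d / 2).choose (d / 4) := by
    have hcard := card_sigma_disjoint_powersetCard (Finset.Icc 1 d) (d / 4)
    rw [Nat.card_Icc, Nat.add_sub_cancel, show d - d / 4 = 3 * d / 4 by omega] at hcard
    rw [← hcard, Finset.sum_mul]
    refine (Finset.card_le_card hpairs).trans (Finset.card_biUnion_le.trans ?_)
    refine Finset.sum_le_sum fun i _ => ?_
    simpa only [Finset.card_sigma, Finset.sum_const, smul_eq_mul] using hmul i
  have hpos : 0 < (d / 2).choose (d / 4) := Nat.choose_pos (by omega)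
  rw [div_le_iff₀ (by exact_mod_cast hpos)]
  exact_mod_cast hcount
end

section
/- Let c := (log₂ 3 - 1)/2. For all reals α ∈ [-1/10, 1/10] and β ∈ [0, 1/10], the binary entropy function satisfies (1/2 + β) · h(1/2 - cα/(1/2 + β)) ≥ 1/2 + β - 0.7·α². -/
/-- The binary entropy function `h(p) = -p·log₂ p - (1-p)·log₂(1-p)`
(with the convention `h(0) = h(1) = 0`, which holds since `Real.logb 2 0 = 0`). -/
noncomputable def binEntropy (p : ℝ) : ℝ :=
  -(p * Real.logb 2 p) - (1 - p) * Real.logb 2 (1 - p)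

lemma log_one_sub_le_of_abs_le {x : ℝ} (hx : |x| ≤ 3 / 25) :
    Real.log (1 - x) ≤ -x - x ^ 2 / 2 + 7 / 50 * x ^ 2 := by
  have h := (abs_le.1 (Real.abs_log_sub_add_sum_range_le (x := x) (by linarith) 2)).2
  simp only [Finset.sum_range_succ, Finset.sum_range_zero] at h
  norm_num at h
  have h2 : |x| ^ 3 / (1 - |x|) ≤ 7 / 50 * x ^ 2 := by
    rw [div_le_iff₀ (by linarith), ← sq_abs x]
    nlinarith [mul_nonneg (sq_nonneg |x|) (sub_nonneg.2 hx)]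
  linarith

lemma one_sub_mul_log_add_one_add_mul_log_le {x : ℝ} (hx : |x| ≤ 3 / 25) :
    (1 - x) * Real.log (1 - x) + (1 + x) * Real.log (1 + x) ≤ 32 / 25 * x ^ 2 := by
  obtain ⟨hl, hu⟩ := abs_le.1 hx
  have h1 := mul_le_mul_of_nonneg_left (log_one_sub_le_of_abs_le hx)
    (by linarith : (0 : ℝ) ≤ 1 - x)
  have h2 := mul_le_mul_of_nonneg_left (log_one_sub_le_of_abs_le (x := -x) (by rwa [abs_neg]))
    (by linarith : (0 : ℝ) ≤ 1 + x)
  rw [sub_neg_eq_add] at h2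
  nlinarith

lemma log_two_sub_le_binEntropy_mul_log_two {t : ℝ} (ht : |2 * t| ≤ 3 / 25) :
    Real.log 2 - 64 / 25 * t ^ 2 ≤ binEntropy (1 / 2 - t) * Real.log 2 := by
  obtain ⟨hl, hu⟩ := abs_le.1 ht
  have h := one_sub_mul_log_add_one_add_mul_log_le ht
  have h1 : Real.log (1 / 2 - t) = Real.log (1 - 2 * t) - Real.log 2 := by
    rw [← Real.log_div (by linarith) two_ne_zero]
    ring_nf
  have h2 : Real.log (1 - (1 / 2 - t)) = Real.log (1 + 2 * t) - Real.log 2 := by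
    rw [← Real.log_div (by linarith) two_ne_zero]
    ring_nf
  have hL : Real.log 2 ≠ 0 := (Real.log_pos one_lt_two).ne'
  have h3 : binEntropy (1 / 2 - t) * Real.log 2 =
      Real.log 2 - ((1 - 2 * t) * Real.log (1 - 2 * t) +
        (1 + 2 * t) * Real.log (1 + 2 * t)) / 2 := by
    simp only [binEntropy, Real.logb, h1, h2]
    field_simp
    ring
  linarith

lemma logb_two_three_mem_Icc : Real.logb 2 3 ∈ Set.Icc (1 : ℝ) (8 / 5) := by
  constructor
  · rw [Real.le_logb_iff_rpow_le one_lt_two (by norm_num)]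
    norm_num
  · have h : (5 : ℝ) * Real.logb 2 3 ≤ 8 := by
      have h5 : Real.logb 2 ((3 : ℝ) ^ 5) = 5 * Real.logb 2 3 := by
        rw [Real.logb_pow]; norm_num
      have h8 : Real.logb 2 ((2 : ℝ) ^ 8) = 8 := by
        rw [Real.logb_pow, Real.logb_self_eq_one one_lt_two]; norm_num
      rw [← h5, ← h8]
      exact Real.logb_le_logb_of_le one_lt_two (by norm_num) (by norm_num)
    linarith

/-- with `c := (log₂ 3 - 1)/2`, for `α ∈ [-1/10, 1/10]` and `β ∈ [0, 1/10]`,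
`(1/2 + β) · h(1/2 - cα/(1/2 + β)) ≥ 1/2 + β - 0.7·α²`. -/
theorem stmt_13 (α β : ℝ) (hα : α ∈ Set.Icc (-(1 / 10) : ℝ) (1 / 10))
    (hβ : β ∈ Set.Icc (0 : ℝ) (1 / 10)) :
    (1 / 2 + β - 0.7 * α ^ 2 : ℝ) ≤
      (1 / 2 + β) *
        binEntropy (1 / 2 - ((Real.logb 2 3 - 1) / 2) * α / (1 / 2 + β)) := by
  obtain ⟨hb1, hb2⟩ := logb_two_three_mem_Icc
  have hs : 1 / 2 ≤ 1 / 2 + β := by linarith [hβ.1]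
  set c := (Real.logb 2 3 - 1) / 2 with hc
  set s := 1 / 2 + β with hs'
  have hc0 : 0 ≤ c := by linarith
  have hc1 : c ≤ 3 / 10 := by linarith
  have hs0 : 0 < s := by linarith
  have hca : |c * α| ≤ 3 / 10 * (1 / 10) := by
    rw [abs_mul, abs_of_nonneg hc0]
    exact mul_le_mul hc1 (abs_le.2 hα) (abs_nonneg _) (by norm_num)
  have ht : |2 * (c * α / s)| ≤ 3 / 25 := by
    rw [abs_mul, abs_div, abs_of_pos hs0, abs_two, ← mul_div_assoc, div_le_iff₀ hs0]
    linarith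
  have h := mul_le_mul_of_nonneg_left (log_two_sub_le_binEntropy_mul_log_two ht) hs0.le
  have hst : s * (c * α / s) ^ 2 ≤ 9 / 50 * α ^ 2 := by
    have : s * (c * α / s) ^ 2 = c ^ 2 * α ^ 2 / s := by field_simp
    rw [this, div_le_iff₀ hs0]
    have hc2 : c ^ 2 ≤ 9 / 100 := by nlinarith
    nlinarith [mul_le_mul_of_nonneg_right hc2 (sq_nonneg α),
      mul_le_mul_of_nonneg_left hs (sq_nonneg α)]
  have hL : 0.693 < Real.log 2 := by linarith [Real.log_two_gt_d9]
  refine le_of_mul_le_mul_right ?_ (Real.log_pos one_lt_two)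
  have hLα := mul_le_mul_of_nonneg_right hL.le (sq_nonneg α)
  norm_num at hLα ⊢
  nlinarith [sq_nonneg α]
end

section
/- Let λ ∈ [0.4, 0.5] and σ ∈ [0.4, 0.6] be reals, and set x := 1/2 + (σ - 1/2)·(log₂ 3)/2 + (1/2 - σ)·(1/2 - λ). Then both of the following hold: (1 - σλ) · h( (x - σλ)/(1 - σλ) ) ≤ (1 - λ) · h( (x - σλ)/(1 - λ) ) + 1/2 + λ - h(λ/2), and (1 - (1-σ)λ) · h( x/(1 - (1-σ)λ) ) ≤ (1 - λ) · h( (x - σλ)/(1 - λ) ) + 1/2 + λ - h(λ/2). (This is the exponential-rate form of the inequality min_x [ C((1-λσ)n, (x-λσ)n) + C((1-(1-σ)λ)n, xn) ] / C((1-λ)n, (x-λσ)n) ≤ 2^{n(1/2 + λ - h(λ/2))} · n^{O(1)}.) -/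
/-- The Bregman-type remainder `(1 + d) log (1 + d) - d` of `t ↦ t log t` at `1`. -/
noncomputable def entropyRemainder (d : ℝ) : ℝ := (1 + d) * Real.log (1 + d) - d

lemma hasDerivAt_entropyRemainder {d : ℝ} (hd : -1 < d) :
    HasDerivAt entropyRemainder (Real.log (1 + d)) d := by
  have hpos : 1 + d ≠ 0 := by linarith
  have h1 : HasDerivAt (fun y : ℝ => 1 + y) 1 d := (hasDerivAt_id d).const_add 1
  refine ((h1.mul (h1.log hpos)).sub (hasDerivAt_id d)).congr_deriv ?_
  field_simp
  ring

lemma entropyRemainder_zero : entropyRemainder 0 = 0 := by simp [entropyRemainder]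

lemma nonneg_of_deriv_nonneg_right {f f' : ℝ → ℝ} {d : ℝ} (hd : 0 ≤ d) (h0 : f 0 = 0)
    (hf : ∀ y, 0 ≤ y → HasDerivAt f (f' y) y) (hf' : ∀ y, 0 ≤ y → 0 ≤ f' y) : 0 ≤ f d := by
  have hmono : MonotoneOn f (Set.Ici 0) := by
    refine monotoneOn_of_hasDerivWithinAt_nonneg (convex_Ici 0)
      (fun y hy => (hf y hy).continuousAt.continuousWithinAt)
      (fun y hy => (hf y (interior_subset hy)).hasDerivWithinAt)
      (fun y hy => hf' y (interior_subset hy))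
  exact h0 ▸ hmono Set.self_mem_Ici hd hd

lemma nonneg_of_deriv_nonpos_left {f f' : ℝ → ℝ} {d : ℝ} (hd : d ≤ 0) (h0 : f 0 = 0)
    (hf : ∀ y, d ≤ y → y ≤ 0 → HasDerivAt f (f' y) y)
    (hf' : ∀ y, d ≤ y → y ≤ 0 → f' y ≤ 0) : 0 ≤ f d := by
  have hanti : AntitoneOn f (Set.Icc d 0) := by
    refine antitoneOn_of_hasDerivWithinAt_nonpos (convex_Icc d 0)
      (fun y hy => (hf y hy.1 hy.2).continuousAt.continuousWithinAt)
      (fun y hy => (hf y (interior_subset hy).1 (interior_subset hy).2).hasDerivWithinAt)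
      (fun y hy => hf' y (interior_subset hy).1 (interior_subset hy).2)
  exact h0 ▸ hanti ⟨le_rfl, hd⟩ ⟨hd, le_rfl⟩ hd

lemma hasDerivAt_const_mul_sq (c y : ℝ) : HasDerivAt (fun t : ℝ => c * t ^ 2) (2 * c * y) y := by
  refine ((hasDerivAt_pow 2 y).const_mul c).congr_deriv ?_
  norm_num
  ring

lemma entropyRemainder_le_half_sq {d : ℝ} (hd : 0 ≤ d) : entropyRemainder d ≤ 1 / 2 * d ^ 2 := by
  rw [← sub_nonneg]
  refine nonneg_of_deriv_nonneg_right (f := fun t => 1 / 2 * t ^ 2 - entropyRemainder t) hd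
    (by simp [entropyRemainder_zero])
    (fun y hy => (hasDerivAt_const_mul_sq (1 / 2) y).sub
      (hasDerivAt_entropyRemainder (by linarith))) (fun y hy => ?_)
  have := Real.log_le_sub_one_of_pos (show 0 < 1 + y by linarith)
  linarith

lemma half_sq_sub_cube_le_entropyRemainder {d : ℝ} (hd : 0 ≤ d) :
    1 / 2 * d ^ 2 - 1 / 6 * d ^ 3 ≤ entropyRemainder d := by
  rw [← sub_nonneg]
  refine nonneg_of_deriv_nonneg_right
    (f := fun t => entropyRemainder t - (1 / 2 * t ^ 2 - 1 / 6 * t ^ 3)) hd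
    (by simp [entropyRemainder_zero])
    (fun y hy => (hasDerivAt_entropyRemainder (by linarith)).sub
      ((hasDerivAt_const_mul_sq (1 / 2) y).sub ((hasDerivAt_pow 3 y).const_mul (1 / 6))))
    (fun y hy => ?_)
  have h1 := Real.le_log_one_add_of_nonneg hy
  have h2 : y - y ^ 2 / 2 ≤ 2 * y / (y + 2) := by
    rw [le_div_iff₀ (by linarith)]
    nlinarith [pow_nonneg hy 3]
  norm_num
  linarith

lemma half_sq_le_entropyRemainder {d : ℝ} (hd : -1 < d) (hd0 : d ≤ 0) :
    1 / 2 * d ^ 2 ≤ entropyRemainder d := by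
  rw [← sub_nonneg]
  refine nonneg_of_deriv_nonpos_left (f := fun t => entropyRemainder t - 1 / 2 * t ^ 2) hd0
    (by simp [entropyRemainder_zero])
    (fun y hy _ => (hasDerivAt_entropyRemainder (by linarith)).sub
      (hasDerivAt_const_mul_sq (1 / 2) y)) (fun y hy _ => ?_)
  have := Real.log_le_sub_one_of_pos (show 0 < 1 + y by linarith)
  linarith

lemma entropyRemainder_le_mul_sq {d : ℝ} (hd : -0.13 ≤ d) :
    entropyRemainder d ≤ 0.575 * d ^ 2 := by
  norm_num at hd ⊢
  rcases le_total 0 d with h | h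
  · nlinarith [entropyRemainder_le_half_sq h, sq_nonneg d]
  rw [← sub_nonneg]
  refine nonneg_of_deriv_nonpos_left (f := fun t => 23 / 40 * t ^ 2 - entropyRemainder t) h
    (by simp [entropyRemainder_zero])
    (fun y hy _ => (hasDerivAt_const_mul_sq (23 / 40) y).sub
      (hasDerivAt_entropyRemainder (by linarith))) (fun y hy hy0 => ?_)
  have hpos : 0 < 1 + y := by linarith
  have h1 := Real.one_sub_inv_le_log_of_pos hpos
  have h2 : 1 - (1 + y)⁻¹ = y / (1 + y) := by field_simp; ring
  have h3 : 2 * (23 / 40) * y ≤ y / (1 + y) := by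
    rw [le_div_iff₀ hpos]
    nlinarith
  linarith

lemma negMulLog_mul_one_add {a d : ℝ} (ha : 0 < a) (hd : -1 < d) :
    Real.negMulLog (a * (1 + d)) =
      -(a * (1 + d)) * Real.log a - a * entropyRemainder d - a * d := by
  rw [Real.negMulLog, Real.log_mul ha.ne' (by linarith), entropyRemainder]
  ring

lemma mul_binEntropy_div {p q a : ℝ} (hp : 0 < p) (hq : 0 < q) (ha : p + q = a) :
    a * binEntropy (p / a) =
      (Real.negMulLog p + Real.negMulLog q - Real.negMulLog a) / Real.log 2 := by
  have ha0 : 0 < a := by linarith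
  have h1 : 1 - p / a = q / a := by field_simp; linarith
  rw [binEntropy, h1]
  simp only [Real.negMulLog, Real.logb, Real.log_div hp.ne' ha0.ne', Real.log_div hq.ne' ha0.ne']
  have := Real.log_pos (show (1 : ℝ) < 2 by norm_num)
  field_simp
  rw [← ha]
  ring

lemma logb_two_three_bounds : 1.58 < Real.logb 2 3 ∧ Real.logb 2 3 < 1.59 := by
  constructor
  · rw [Real.lt_logb_iff_rpow_lt (by norm_num) (by norm_num)]
    rw [← Real.rpow_lt_rpow_iff (z := 50) (by positivity) (by norm_num) (by norm_num),
      ← Real.rpow_mul (by norm_num)]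
    norm_num
  · rw [Real.logb_lt_iff_lt_rpow (by norm_num) (by norm_num)]
    rw [← Real.rpow_lt_rpow_iff (z := 100) (by norm_num) (by positivity) (by norm_num),
      ← Real.rpow_mul (by norm_num)]
    norm_num

lemma log_three_sub_log_two_bounds :
    0.40 < Real.log 3 - Real.log 2 ∧ Real.log 3 - Real.log 2 < 0.42 := by
  have h2 := Real.log_two_gt_d9
  have h2' := Real.log_two_lt_d9
  obtain ⟨hk, hk'⟩ := logb_two_three_bounds
  have h : Real.log 3 = Real.logb 2 3 * Real.log 2 := by
    rw [Real.logb, div_mul_cancel₀]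
    linarith
  norm_num at *
  constructor <;> nlinarith

lemma mul_sq_le_remainder_sum {m : ℝ} (hm : 0 ≤ m) (hm' : m ≤ 1 / 10) :
    159 / 100 * m ^ 2 ≤ 1 / 2 * entropyRemainder (2 * m)
      + 1 / 4 * entropyRemainder (-(2 * m)) + 3 / 4 * entropyRemainder (2 / 3 * m) := by
  have e1 := half_sq_sub_cube_le_entropyRemainder (d := 2 * m) (by linarith)
  have e2 := half_sq_le_entropyRemainder (d := -(2 * m)) (by linarith) (by linarith)
  have e3 := half_sq_sub_cube_le_entropyRemainder (d := 2 / 3 * m) (by linarith)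
  have hm3 : m ^ 3 ≤ 1 / 10 * m ^ 2 := by nlinarith [sq_nonneg m]
  nlinarith [sq_nonneg m]

lemma remainder_combination_nonneg_of_nonneg {u m k c : ℝ} (h : 0 ≤ u) (hu' : u ≤ 1 / 10)
    (hm : 0 ≤ m) (hm' : m ≤ 1 / 10) (hk : 79 / 50 < k) (hk' : k < 159 / 100) (hc' : c < 21 / 50) :
    0 ≤ -c * (u * m) - 1 / 4 * entropyRemainder (2 * m - 2 * (k - 1) * u)
      + 1 / 2 * entropyRemainder (-(k * u) + 2 * u * m)
      - 3 / 4 * entropyRemainder (2 / 3 * (m - u + 2 * u * m))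
      + 1 / 2 * entropyRemainder (2 * m)
      + 1 / 4 * entropyRemainder (-(2 * m)) + 3 / 4 * entropyRemainder (2 / 3 * m) := by
  have hA := mul_sq_le_remainder_sum hm hm'
  have hum := mul_nonneg h hm
  have e4 := entropyRemainder_le_mul_sq (d := 2 * m - 2 * (k - 1) * u)
    (by norm_num; nlinarith)
  have e5 := entropyRemainder_le_mul_sq (d := 2 / 3 * (m - u + 2 * u * m))
    (by norm_num; nlinarith)
  have e6 := half_sq_le_entropyRemainder (d := -(k * u) + 2 * u * m)
    (by nlinarith) (by nlinarith)
  have e7 : (138 / 100 * u) ^ 2 ≤ (-(k * u) + 2 * u * m) ^ 2 := by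
    rw [← neg_sq (-(k * u) + 2 * u * m)]
    exact pow_le_pow_left₀ (by positivity) (by nlinarith) 2
  have e8 : (2 * m - 2 * (k - 1) * u) ^ 2 ≤ 4 * m ^ 2 - 464 / 100 * (u * m)
      + 14 / 10 * u ^ 2 := by
    have : (k - 1) ^ 2 ≤ 35 / 100 := by nlinarith
    linarith [mul_nonneg hum (sub_nonneg.2 hk.le), mul_nonneg (sq_nonneg u) (sub_nonneg.2 this)]
  have e9 : (m - u + 2 * u * m) ^ 2 ≤ 144 / 100 * m ^ 2 + u ^ 2 := by
    have hu2 : u ^ 2 ≤ 1 / 100 := by nlinarith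
    linarith [mul_nonneg hum h, mul_nonneg hum (sub_nonneg.2 hm'), sq_nonneg m,
      mul_nonneg (sq_nonneg m) (sub_nonneg.2 hu2)]
  norm_num at e4 e5
  linarith [mul_nonneg hum (sub_nonneg.2 hc'.le), sq_nonneg m, sq_nonneg u]

lemma remainder_combination_nonneg_of_nonpos {v m k c : ℝ} (hv : 0 ≤ v) (hv' : v ≤ 1 / 10)
    (hm : 0 ≤ m) (hm' : m ≤ 1 / 10) (hk : 79 / 50 < k) (hk' : k < 159 / 100) (hc : 2 / 5 < c) :
    0 ≤ c * (v * m) - 1 / 4 * entropyRemainder (2 * m + 2 * (k - 1) * v)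
      + 1 / 2 * entropyRemainder (k * v - 2 * v * m)
      - 3 / 4 * entropyRemainder (2 / 3 * (m + v - 2 * v * m))
      + 1 / 2 * entropyRemainder (2 * m)
      + 1 / 4 * entropyRemainder (-(2 * m)) + 3 / 4 * entropyRemainder (2 / 3 * m) := by
  have hA := mul_sq_le_remainder_sum hm hm'
  have hvm := mul_nonneg hv hm
  have hvk := mul_nonneg hv (sub_nonneg.2 hk.le)
  have hvk' := mul_nonneg hv (sub_nonneg.2 hk'.le)
  have hvm' := mul_nonneg hv (sub_nonneg.2 hm')
  have e4 := entropyRemainder_le_half_sq (d := 2 * m + 2 * (k - 1) * v) (by linarith)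
  have e5 := entropyRemainder_le_half_sq (d := 2 / 3 * (m + v - 2 * v * m))
    (by linarith)
  have hd0 : 138 / 100 * v ≤ k * v - 2 * v * m := by linarith
  have hd1 : k * v - 2 * v * m ≤ 159 / 1000 := by linarith
  have e6 := half_sq_sub_cube_le_entropyRemainder (d := k * v - 2 * v * m)
    (by linarith)
  have e7 : (138 / 100 * v) ^ 2 ≤ (k * v - 2 * v * m) ^ 2 :=
    pow_le_pow_left₀ (by positivity) hd0 2
  have e7' : (k * v - 2 * v * m) ^ 3 ≤
      159 / 1000 * (k * v - 2 * v * m) ^ 2 := by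
    linarith [mul_nonneg (sq_nonneg (k * v - 2 * v * m)) (sub_nonneg.2 hd1)]
  have e8 : (2 * m + 2 * (k - 1) * v) ^ 2 ≤ 4 * m ^ 2 + 472 / 100 * (v * m)
      + 14 / 10 * v ^ 2 := by
    have : (k - 1) ^ 2 ≤ 35 / 100 := by nlinarith
    linarith [mul_nonneg hvm (sub_nonneg.2 hk'.le),
      mul_nonneg (sq_nonneg v) (sub_nonneg.2 this)]
  have e9 : (m + v - 2 * v * m) ^ 2 ≤ (m + v) ^ 2 :=
    pow_le_pow_left₀ (by linarith) (by linarith) 2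
  linarith [mul_nonneg hvm (sub_nonneg.2 hc.le), sq_nonneg m, sq_nonneg v,
    sq_nonneg (m - 29 / 100 * v)]

lemma remainder_combination_nonneg {u m k c : ℝ} (hu : -0.1 ≤ u) (hu' : u ≤ 0.1) (hm : 0 ≤ m)
    (hm' : m ≤ 0.1) (hk : 1.58 < k) (hk' : k < 1.59) (hc : 0.40 < c) (hc' : c < 0.42) :
    0 ≤ -c * (u * m) - 1 / 4 * entropyRemainder (2 * m - 2 * (k - 1) * u)
      + 1 / 2 * entropyRemainder (-(k * u) + 2 * u * m)
      - 3 / 4 * entropyRemainder (2 / 3 * (m - u + 2 * u * m))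
      + 1 / 2 * entropyRemainder (2 * m) + 1 / 4 * entropyRemainder (-(2 * m))
      + 3 / 4 * entropyRemainder (2 / 3 * m) := by
  norm_num at hu hu' hm' hk hk' hc hc'
  rcases le_total 0 u with h | h
  · exact remainder_combination_nonneg_of_nonneg h hu' hm hm' hk hk' hc'
  · convert remainder_combination_nonneg_of_nonpos (v := -u) (by linarith) (by linarith) hm hm'
      hk hk' hc using 7 <;> ring_nf

lemma negMulLog_combination_nonneg {l σ x : ℝ} (hl : 0.4 ≤ l) (hl' : l ≤ 0.5) (hσ : 0.4 ≤ σ)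
    (hσ' : σ ≤ 0.6)
    (hx : x = 1 / 2 + (σ - 1 / 2) * (Real.logb 2 3) / 2 + (1 / 2 - σ) * (1 / 2 - l)) :
    0 ≤ Real.negMulLog (1 - x - (1 - σ) * l) - Real.negMulLog (1 - x)
      + Real.negMulLog (1 - σ * l) - Real.negMulLog (1 - l) + (1 / 2 + l) * Real.log 2
      - Real.negMulLog (l / 2) - Real.negMulLog (1 - l / 2) := by
  obtain ⟨hk, hk'⟩ := logb_two_three_bounds
  obtain ⟨hc, hc'⟩ := log_three_sub_log_two_bounds
  have h2 := Real.log_pos (show (1 : ℝ) < 2 by norm_num)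
  have hkl : Real.logb 2 3 * Real.log 2 = Real.log 3 := by
    rw [Real.logb, div_mul_cancel₀ _ h2.ne']
  have key := remainder_combination_nonneg (u := σ - 1 / 2) (m := 1 / 2 - l)
    (by norm_num at *; linarith) (by norm_num at *; linarith) (by norm_num at *; linarith)
    (by norm_num at *; linarith) hk hk' hc hc'
  set k := Real.logb 2 3
  obtain ⟨u, rfl⟩ : ∃ u, σ = u + 1 / 2 := ⟨σ - 1 / 2, by ring⟩
  obtain ⟨m, rfl⟩ : ∃ m, l = 1 / 2 - m := ⟨1 / 2 - l, by ring⟩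
  norm_num at hl hl' hσ hσ' hk hk'
  have hu : -(1 / 10) ≤ u := by linarith
  have hu' : u ≤ 1 / 10 := by linarith
  have hm' : m ≤ 1 / 10 := by linarith
  rw [show u + 1 / 2 - 1 / 2 = u by ring, show 1 / 2 - (1 / 2 - m) = m by ring] at key
  subst hx
  have a1 := negMulLog_mul_one_add (a := 1 / 4) (d := 2 * m - 2 * (k - 1) * u)
    (by norm_num) (by nlinarith)
  have a2 := negMulLog_mul_one_add (a := 1 / 2) (d := -(k * u) + 2 * u * m)
    (by norm_num) (by nlinarith)
  have a3 := negMulLog_mul_one_add (a := 3 / 4) (d := 2 / 3 * (m - u + 2 * u * m))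
    (by norm_num) (by nlinarith)
  have a4 := negMulLog_mul_one_add (a := 1 / 2) (d := 2 * m) (by norm_num) (by linarith)
  have a5 := negMulLog_mul_one_add (a := 1 / 4) (d := -(2 * m)) (by norm_num) (by linarith)
  have a6 := negMulLog_mul_one_add (a := 3 / 4) (d := 2 / 3 * m) (by norm_num) (by linarith)
  have l4 : Real.log 4 = 2 * Real.log 2 := by
    rw [show (4 : ℝ) = 2 ^ 2 by norm_num, Real.log_pow]; norm_num
  have l14 : Real.log (1 / 4) = -(2 * Real.log 2) := by
    rw [one_div, Real.log_inv, l4]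
  have l12 : Real.log (1 / 2) = -Real.log 2 := by
    rw [one_div, Real.log_inv]
  have l34 : Real.log (3 / 4) = Real.log 3 - 2 * Real.log 2 := by
    rw [Real.log_div (by norm_num) (by norm_num), l4]
  rw [l14] at a1 a5
  rw [l12] at a2 a4
  rw [l34] at a3 a6
  rw [show 1 - (1 / 2 + (u + 1 / 2 - 1 / 2) * k / 2 +
        (1 / 2 - (u + 1 / 2)) * (1 / 2 - (1 / 2 - m))) - (1 - (u + 1 / 2)) * (1 / 2 - m) =
      1 / 4 * (1 + (2 * m - 2 * (k - 1) * u)) by ring,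
    show 1 - (1 / 2 + (u + 1 / 2 - 1 / 2) * k / 2 +
        (1 / 2 - (u + 1 / 2)) * (1 / 2 - (1 / 2 - m))) =
      1 / 2 * (1 + (-(k * u) + 2 * u * m)) by ring,
    show 1 - (u + 1 / 2) * (1 / 2 - m) = 3 / 4 * (1 + 2 / 3 * (m - u + 2 * u * m)) by ring,
    show 1 - (1 / 2 - m) = 1 / 2 * (1 + 2 * m) by ring,
    show (1 / 2 - m) / 2 = 1 / 4 * (1 + -(2 * m)) by ring,
    show 1 - 1 / 4 * (1 + -(2 * m)) = 3 / 4 * (1 + 2 / 3 * m) by ring,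
    a1, a2, a3, a4, a5, a6]
  refine key.trans_eq ?_
  rw [← hkl]
  ring

/-- For `λ ∈ [0.4, 0.5]`, `σ ∈ [0.4, 0.6]` and
`x := 1/2 + (σ - 1/2)·(log₂ 3)/2 + (1/2 - σ)·(1/2 - λ)`, both
`(1 - σλ)·h((x - σλ)/(1 - σλ)) ≤ (1 - λ)·h((x - σλ)/(1 - λ)) + 1/2 + λ - h(λ/2)` and
`(1 - (1-σ)λ)·h(x/(1 - (1-σ)λ)) ≤ (1 - λ)·h((x - σλ)/(1 - λ)) + 1/2 + λ - h(λ/2)` hold. -/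
theorem stmt_16 (l σ : ℝ) (hl : l ∈ Set.Icc (0.4 : ℝ) 0.5)
    (hσ : σ ∈ Set.Icc (0.4 : ℝ) 0.6)
    (x : ℝ) (hx : x = 1 / 2 + (σ - 1 / 2) * (Real.logb 2 3) / 2 + (1 / 2 - σ) * (1 / 2 - l)) :
    (1 - σ * l) * binEntropy ((x - σ * l) / (1 - σ * l)) ≤
        (1 - l) * binEntropy ((x - σ * l) / (1 - l)) + 1 / 2 + l - binEntropy (l / 2) ∧
      (1 - (1 - σ) * l) * binEntropy (x / (1 - (1 - σ) * l)) ≤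
        (1 - l) * binEntropy ((x - σ * l) / (1 - l)) + 1 / 2 + l - binEntropy (l / 2) := by
  obtain ⟨hl1, hl2⟩ := hl
  obtain ⟨hs1, hs2⟩ := hσ
  have f1 := negMulLog_combination_nonneg hl1 hl2 hs1 hs2 hx
  have f2 := negMulLog_combination_nonneg (σ := 1 - σ) (x := 1 - x) hl1 hl2
    (by norm_num at *; linarith) (by norm_num at *; linarith) (by rw [hx]; ring)
  obtain ⟨hk, hk'⟩ := logb_two_three_bounds
  have h2 := Real.log_pos (show (1 : ℝ) < 2 by norm_num)
  norm_num at hl1 hl2 hs1 hs2 hk hk'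
  have hx1 : 0.4 ≤ x ∧ x ≤ 0.6 := by
    rw [hx]
    norm_num
    constructor <;> nlinarith
  obtain ⟨hx1, hx2⟩ := hx1
  norm_num at hx1 hx2
  have hy : 0 < x - σ * l := by nlinarith
  have hz : 0 < 1 - x - (1 - σ) * l := by nlinarith
  have b1 := mul_binEntropy_div (p := x - σ * l) (q := 1 - x) (a := 1 - σ * l) hy
    (by linarith) (by ring)
  have b2 := mul_binEntropy_div (p := x) (q := 1 - x - (1 - σ) * l) (a := 1 - (1 - σ) * l)
    (by linarith) hz (by ring)
  have b3 := mul_binEntropy_div (p := x - σ * l) (q := 1 - x - (1 - σ) * l) (a := 1 - l) hy hz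
    (by ring)
  have b4 := mul_binEntropy_div (p := l / 2) (q := 1 - l / 2) (a := 1) (by linarith)
    (by linarith) (by ring)
  rw [one_mul, div_one, Real.negMulLog_one, sub_zero] at b4
  rw [b1, b2, b3, b4]
  rw [show 1 - (1 - x) - (1 - (1 - σ)) * l = x - σ * l by ring,
    show 1 - (1 - x) = x by ring] at f2
  have hlog : (1 / 2 + l) * Real.log 2 / Real.log 2 = 1 / 2 + l :=
    mul_div_cancel_right₀ _ h2.ne'
  have g1 := div_nonneg f1 h2.le
  have g2 := div_nonneg f2 h2.le
  simp only [add_div, sub_div, hlog] at g1 g2 ⊢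
  constructor <;> linarith
end
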